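/- Let k be a field, n a natural number, and R a finite-type k-algebra which is an integral domain. Then the transcendence degree of Frac(R) over k equals the Krull dimension of R. -/

import Mathlib

/-- An injective integral extension preserves the Krull dimension. -/
theorem ringKrullDim_eq_of_isIntegral_of_faithfulSMul (R S : Type*) [CommRing R] [CommRing S]
    [Algebra R S] [Algebra.IsIntegral R S] [FaithfulSMul R S] :
    ringKrullDim S = ringKrullDim R := by
  refine le_antisymm
    (Order.krullDim_le_of_strictMono (PrimeSpectrum.comap (algebraMap R S))
      fun _ _ h ↦ Ideal.IsIntegral.comap_lt_comap h) (iSup_le fun l ↦ ?_)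
  obtain ⟨P, _, _⟩ : Nonempty (l.head.asIdeal.primesOver S) := inferInstance
  obtain ⟨L, hL, -, -⟩ := Ideal.exists_ltSeries_of_hasGoingUp l P
  exact hL ▸ Order.LTSeries.length_le_krullDim L

/-- Let `k` be a field and `R` a finite-type `k`-algebra which is an integral domain.
Then the transcendence degree of `Frac(R)` over `k` equals the Krull dimension of `R`:
there is a finite transcendence basis of `Frac(R)` over `k` whose cardinality is the
Krull dimension of `R`. -/
theorem trdeg_fractionRing_eq_krullDim
    {k R : Type} [Field k] [CommRing R] [IsDomain R] [Algebra k R]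
    (hft : Algebra.FiniteType k R) :
    ∃ s : Finset (FractionRing R),
      IsTranscendenceBasis k (Subtype.val : {y // y ∈ s} → FractionRing R) ∧
      ringKrullDim R = s.card := by
  classical
  obtain ⟨n, g, hg, hint⟩ := exists_integral_inj_algHom_of_fg k R
  algebraize [g.toRingHom]
  have : IsScalarTower k (MvPolynomial (Fin n) k) R :=
    .of_algebraMap_eq fun x ↦ (g.commutes x).symm
  have : FaithfulSMul (MvPolynomial (Fin n) k) R :=
    (faithfulSMul_iff_algebraMap_injective _ _).mpr hg
  have : Algebra.IsAlgebraic R (FractionRing R) :=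
    IsLocalization.isAlgebraic (FractionRing R) (nonZeroDivisors R)
  have hx := ((IsTranscendenceBasis.mvPolynomial (Fin n) k).algebraMap_comp
    (A := R)).algebraMap_comp (A := FractionRing R)
  refine ⟨Finset.univ.image (_ : Fin n → _), hx.to_subtype_range' (by
    rw [Finset.coe_image, Finset.coe_univ, Set.image_univ]), ?_⟩
  rw [Finset.card_image_of_injective _ hx.1.injective,
    ringKrullDim_eq_of_isIntegral_of_faithfulSMul (MvPolynomial (Fin n) k) R,
    MvPolynomial.ringKrullDim_of_isNoetherianRing]
  simp
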